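/- Let N ≥ 1. In ℂ[F_N], the fourth power of the generating operator satisfies G^4 = X_4 + (2(2N−1) + 2N)·X_2 + 2N((2N−1) + 2N)·1, i.e. G^4 = X_4 + (6N−2)·X_2 + 2N(4N−1)·1. -/

import Mathlib

/-- `X N n` is the sum, in the complex group algebra `ℂ[F_N]`, of all group elements
whose reduced word has length `n`. -/
noncomputable def X (N : ℕ) (n : ℕ) : MonoidAlgebra ℂ (FreeGroup (Fin N)) :=
  ∑ᶠ g ∈ {g : FreeGroup (Fin N) | g.norm = n}, MonoidAlgebra.of ℂ (FreeGroup (Fin N)) g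

open FreeGroup in
/-- Multiplying on the left by the inverse of a letter `p` cancels `p` if the reduced word starts
with `p`, and lengthens the word by one otherwise. -/
theorem norm_letter_inv_mul {α : Type*} [DecidableEq α] (p : α × Bool) (g : FreeGroup α) :
    ((mk [p])⁻¹ * g).norm = if g.toWord.head? = some p then g.norm - 1 else g.norm + 1 := by
  have h : ((mk [p])⁻¹ * g).toWord = reduce ((p.1, !p.2) :: g.toWord) := by
    conv_lhs => rw [← mk_toWord (x := g)]
    rw [inv_mk, mul_mk, toWord_mk]
    simp [invRev]
  rw [FreeGroup.norm, h, reduce.cons, reduce_toWord, FreeGroup.norm]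
  obtain ⟨a, b⟩ := p
  cases g.toWord with
  | nil => simp
  | cons q t =>
    obtain ⟨c, d⟩ := q
    by_cases hq : c = a ∧ d = b
    · simp [hq]
    · have hq' : ¬ (a = c ∧ b = d) := fun h => hq ⟨h.1.symm, h.2.symm⟩
      simp [hq, hq']

theorem finite_norm_eq (α : Type*) [DecidableEq α] [Finite α] (n : ℕ) :
    {g : FreeGroup α | g.norm = n}.Finite :=
  (List.finite_length_eq (α × Bool) n).preimage FreeGroup.toWord_injective.injOn

theorem coeff_X (N n : ℕ) (g : FreeGroup (Fin N)) :
    (X N n).coeff g = if g.norm = n then 1 else 0 := by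
  classical
  rw [X, finsum_mem_eq_finite_toFinset_sum _ (finite_norm_eq (Fin N) n)]
  simp [MonoidAlgebra.of_apply, Finsupp.single_apply]

theorem X_zero (N : ℕ) : X N 0 = 1 := by
  ext g
  simp [coeff_X, MonoidAlgebra.one_def, Finsupp.single_apply, eq_comm]

/-- The generating operator is the sum over all letters. -/
theorem X_one_eq_sum (N : ℕ) :
    X N 1 = ∑ p : Fin N × Bool, MonoidAlgebra.single (FreeGroup.mk [p]) (1 : ℂ) := by
  have hinj : Function.Injective fun p : Fin N × Bool => FreeGroup.mk [p] := fun p q h => by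
    simpa [FreeGroup.toWord_mk, FreeGroup.reduce_singleton] using
      congrArg FreeGroup.toWord h
  have hrange : {g : FreeGroup (Fin N) | g.norm = 1} =
      Set.range fun p : Fin N × Bool => FreeGroup.mk [p] := by
    ext g
    simp only [Set.mem_ofPred_eq, Set.mem_range, FreeGroup.norm, List.length_eq_one_iff]
    refine exists_congr fun p => ?_
    rw [← FreeGroup.toWord_inj, FreeGroup.toWord_mk, FreeGroup.reduce_singleton, eq_comm]
  rw [X, hrange, finsum_mem_range hinj, finsum_eq_sum_of_fintype]
  rfl

theorem coeff_X_one_mul (N : ℕ) (f : MonoidAlgebra ℂ (FreeGroup (Fin N)))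
    (g : FreeGroup (Fin N)) :
    (X N 1 * f).coeff g = ∑ p : Fin N × Bool, f.coeff ((FreeGroup.mk [p])⁻¹ * g) := by
  simp [X_one_eq_sum, Finset.sum_mul, MonoidAlgebra.coeff_sum, -FreeGroup.inv_mk]

theorem coeff_X_one_mul_X_at_one (N n : ℕ) :
    (X N 1 * X N n).coeff 1 = if n = 1 then 2 * (N : ℂ) else 0 := by
  simp [coeff_X_one_mul, coeff_X, norm_letter_inv_mul, mul_comm, eq_comm (a := n),
    -FreeGroup.inv_mk, -mul_one]

theorem coeff_X_one_mul_X_of_ne_one (N n : ℕ) {g : FreeGroup (Fin N)} (hg : g ≠ 1) :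
    (X N 1 * X N n).coeff g = (if g.norm = n + 1 then 1 else 0) +
      (2 * (N : ℂ) - 1) * if g.norm + 1 = n then 1 else 0 := by
  obtain ⟨q, t, hw⟩ := List.exists_cons_of_ne_nil (mt FreeGroup.toWord_eq_nil_iff.mp hg)
  have hnorm : g.norm = t.length + 1 := by simp [FreeGroup.norm, hw]
  have h (p : Fin N × Bool) : (X N n).coeff ((FreeGroup.mk [p])⁻¹ * g) =
      (if g.norm + 1 = n then 1 else 0) +
        if q = p then (if g.norm = n + 1 then 1 else 0) - (if g.norm + 1 = n then 1 else 0)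
          else 0 := by
    rw [coeff_X, norm_letter_inv_mul, hw, hnorm]
    by_cases hp : q = p <;> simp [hp]
  rw [coeff_X_one_mul]
  simp only [h, Finset.sum_add_distrib, Finset.sum_ite_eq, Finset.mem_univ, if_true,
    Finset.sum_const, Finset.card_univ, Fintype.card_prod, Fintype.card_fin, Fintype.card_bool,
    nsmul_eq_mul, Nat.cast_mul, Nat.cast_ofNat]
  ring

theorem X_one_mul_X_one (N : ℕ) :
    X N 1 * X N 1 = X N 2 + (2 * (N : ℂ)) • 1 := by
  rw [← X_zero]
  ext g
  by_cases hg : g = 1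
  · simp [hg, coeff_X_one_mul_X_at_one, coeff_X]
  · simp [coeff_X_one_mul_X_of_ne_one N 1 hg, coeff_X, hg]

theorem X_one_mul_X_add_two (N n : ℕ) :
    X N 1 * X N (n + 2) = X N (n + 3) + (2 * (N : ℂ) - 1) • X N (n + 1) := by
  ext g
  by_cases hg : g = 1
  · simp [hg, coeff_X_one_mul_X_at_one, coeff_X]
  · simp [coeff_X_one_mul_X_of_ne_one N (n + 2) hg, coeff_X]

/-- The fourth power of the generating operator `G = X₁` of `ℂ[F_N]` satisfies
`G⁴ = X₄ + (6N−2)·X₂ + 2N(4N−1)·1`. -/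
theorem stmt6 (N : ℕ) (hN : 1 ≤ N) :
    (X N 1) ^ 4 = X N 4 + (6 * (N : ℂ) - 2) • X N 2 +
      (2 * (N : ℂ) * (4 * N - 1)) • (1 : MonoidAlgebra ℂ (FreeGroup (Fin N))) := by
  rw [pow_succ', pow_succ', pow_two, X_one_mul_X_one, mul_add, X_one_mul_X_add_two N 0,
    mul_smul_comm, mul_one, add_assoc, ← add_smul, mul_add, X_one_mul_X_add_two N 1,
    mul_smul_comm, zero_add, X_one_mul_X_one]
  module
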